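/- arXiv:1903.06119 — 2 statements merged into one kernel-verified Lean document; each statement's English description precedes it below -/
import Mathlib

section
/- Let xl, xu ∈ 𝔽 with xl ≤ xu. Then the maximum of x + ∇2n+(x)/2 over all x ∈ 𝔽 with xl ≤ x ≤ xu is attained at xu; that is, for every x ∈ 𝔽 with xl ≤ x ≤ xu one has x + ∇2n+(x)/2 ≤ xu + ∇2n+(xu)/2. -/
noncomputable section

open scoped Classical

namespace FPVerif

/-- The set of finite IEEE 754 binary floating-point numbers with
precision `p` and maximum exponent `emax` (minimum exponent `1 - emax`),
viewed as a set of real numbers. -/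
def F (p emax : ℤ) : Set ℝ :=
  {x | ∃ (s : ℝ) (e M : ℤ), (s = 1 ∨ s = -1) ∧
    1 - emax ≤ e ∧ e ≤ emax ∧ (0 : ℝ) ≤ (M : ℝ) ∧ (M : ℝ) ≤ (2 : ℝ) ^ p - 1 ∧
    x = s * (M : ℝ) * (2 : ℝ) ^ (e + 1 - p)}

/-- The smallest positive float. -/
def fmin (p emax : ℤ) : ℝ := (2 : ℝ) ^ ((1 - emax) + 1 - p)

/-- The largest float. -/
def fmax (p emax : ℤ) : ℝ := (2 : ℝ) ^ emax * (2 - (2 : ℝ) ^ (1 - p))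

/-- The successor of `x` in `F p emax` (meaningful when `x ∈ F` and `x < fmax`). -/
def fsucc (p emax : ℤ) (x : ℝ) : ℝ := sInf {y | y ∈ F p emax ∧ x < y}

/-- The predecessor of `x` in `F p emax` (meaningful when `x ∈ F` and `-fmax < x`). -/
def fpred (p emax : ℤ) (x : ℝ) : ℝ := sSup {y | y ∈ F p emax ∧ y < x}

/-- Round toward minus infinity, valued in the extended reals. -/
def rndDown (p emax : ℤ) (x : ℝ) : EReal :=
  if x < -fmax p emax then ⊥
  else ((sSup {z | z ∈ F p emax ∧ z ≤ x} : ℝ) : EReal)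

/-- Round toward plus infinity, valued in the extended reals. -/
def rndUp (p emax : ℤ) (x : ℝ) : EReal :=
  if fmax p emax < x then ⊤
  else ((sInf {z | z ∈ F p emax ∧ x ≤ z} : ℝ) : EReal)

/-- Round toward zero, valued in the extended reals. -/
def rndZero (p emax : ℤ) (x : ℝ) : EReal :=
  if 0 < x then rndDown p emax x else rndUp p emax x

/-- A float `z` is even if it is zero or its mantissa digit string ends in 0,
i.e. `z / 2 ^ (e_z + 1 - p)` is an even integer, where
`e_z = max (1 - emax) ⌊log₂ |z|⌋`. -/
def FEven (p emax : ℤ) (z : ℝ) : Prop :=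
  z = 0 ∨ ∃ k : ℤ, Even k ∧
    z = (k : ℝ) * (2 : ℝ) ^ (max (1 - emax) (Int.log 2 |z|) + 1 - p)

/-- The set of floats at minimal distance from `x`. -/
def nearestSet (p emax : ℤ) (x : ℝ) : Set ℝ :=
  {z | z ∈ F p emax ∧ ∀ w ∈ F p emax, |x - z| ≤ |x - w|}

/-- The float at minimal distance from `x`, a tie being broken by
choosing the even one. -/
def nearest (p emax : ℤ) (x : ℝ) : ℝ :=
  if h : ∃ z, z ∈ nearestSet p emax x ∧ FEven p emax z then h.choose
  else if h2 : ∃ z, z ∈ nearestSet p emax x then h2.choose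
  else 0

/-- Round to nearest (ties to even), valued in the extended reals. -/
def rndNear (p emax : ℤ) (x : ℝ) : EReal :=
  if (2 : ℝ) ^ emax * (2 - (2 : ℝ) ^ (-p)) ≤ x then ⊤
  else if x ≤ -((2 : ℝ) ^ emax * (2 - (2 : ℝ) ^ (-p))) then ⊥
  else ((nearest p emax x : ℝ) : EReal)

/-- Twice the downward round-to-nearest error bound `∇2n−`. -/
def nablaNm (p emax : ℤ) (x : ℝ) : ℝ :=
  if x = -fmax p emax then x - fsucc p emax x else fpred p emax x - x

/-- Twice the upward round-to-nearest error bound `∇2n+`. -/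
def nablaNp (p emax : ℤ) (x : ℝ) : ℝ :=
  if x = fmax p emax then x - fpred p emax x else fsucc p emax x - x

end FPVerif

open FPVerif

lemma fmax_eq_aux (p emax : ℤ) :
    fmax p emax = ((2 : ℝ) ^ p - 1) * (2 : ℝ) ^ (emax + 1 - p) := by
  have h2 : (2 : ℝ) ≠ 0 := two_ne_zero
  have hp : (2 : ℝ) ^ p ≠ 0 := zpow_ne_zero _ h2
  unfold fmax
  rw [zpow_sub₀ h2, zpow_sub₀ h2, zpow_add₀ h2]
  field_simp

lemma fmax_mem_aux (p emax : ℤ) (hp : 2 ≤ p) (he : 1 ≤ emax) :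
    fmax p emax ∈ F p emax := by
  have hc : (((2 : ℤ) ^ p.toNat - 1 : ℤ) : ℝ) = (2 : ℝ) ^ p - 1 := by
    push_cast
    rw [← zpow_natCast, Int.toNat_of_nonneg (by omega)]
  refine ⟨1, emax, 2 ^ p.toNat - 1, Or.inl rfl, by omega, le_refl _, ?_, ?_, ?_⟩
  · rw [hc]
    have : (1 : ℝ) ≤ (2 : ℝ) ^ p := one_le_zpow₀ (by norm_num) (by omega)
    linarith
  · rw [hc]
  · rw [hc, fmax_eq_aux, one_mul]

lemma le_fmax_aux (p emax : ℤ) (x : ℝ) (hx : x ∈ F p emax) :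
    x ≤ fmax p emax := by
  obtain ⟨s, e, M, hs, h1, h2, h3, h4, rfl⟩ := hx
  rw [fmax_eq_aux]
  have hpos : (0 : ℝ) < (2 : ℝ) ^ (e + 1 - p) := by positivity
  have hle : (2 : ℝ) ^ (e + 1 - p) ≤ (2 : ℝ) ^ (emax + 1 - p) :=
    zpow_le_zpow_right₀ (by norm_num) (by omega)
  have hsM : s * (M : ℝ) ≤ M := by
    rcases hs with rfl | rfl <;> linarith
  calc s * (M : ℝ) * (2 : ℝ) ^ (e + 1 - p) ≤ M * (2 : ℝ) ^ (e + 1 - p) :=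
        mul_le_mul_of_nonneg_right hsM hpos.le
    _ ≤ _ := mul_le_mul h4 hle hpos.le (h3.trans h4)

/-- The maximum of `x + ∇2n+(x)/2` over floats `x` with `xl ≤ x ≤ xu` is
attained at `xu`. -/
theorem max_add_half_nablaNp (p emax : ℤ) (hp : 2 ≤ p) (he : 1 ≤ emax)
    (xl xu : ℝ) (hxl : xl ∈ F p emax) (hxu : xu ∈ F p emax) (hle : xl ≤ xu) :
    ∀ x ∈ F p emax, xl ≤ x → x ≤ xu →
      x + nablaNp p emax x / 2 ≤ xu + nablaNp p emax xu / 2 := by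
  intro x hx _ hxxu
  rcases hxxu.eq_or_lt with rfl | hlt
  · exact le_refl _
  have hxuf := le_fmax_aux p emax xu hxu
  have hxne : x ≠ fmax p emax := (hlt.trans_le hxuf).ne
  have h1 : fsucc p emax x ≤ xu :=
    csInf_le ⟨x, fun y hy => hy.2.le⟩ ⟨hxu, hlt⟩
  have h2 : 0 ≤ nablaNp p emax xu := by
    unfold nablaNp
    split_ifs with h
    · have : fpred p emax xu ≤ xu := csSup_le ⟨x, hx, hlt⟩ (fun y hy => hy.2.le)
      linarith
    · have : xu ≤ fsucc p emax xu :=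
        le_csInf ⟨fmax p emax, fmax_mem_aux p emax hp he, lt_of_le_of_ne hxuf h⟩
          (fun y hy => hy.2.le)
      linarith
  have h3 : nablaNp p emax x = fsucc p emax x - x := if_neg hxne
  rw [h3]
  linarith
end
end

section
/- Let x ∈ 𝔽 and r ∈ ℝ. If x ≤ [r]n (as extended reals) then x + ∇2n−(x)/2 ≤ r, and the inequality is strict whenever x is odd. -/
noncomputable section

open scoped Classical

namespace FPVerif

def u (p e : ℤ) : ℝ := (2 : ℝ) ^ (e + 1 - p)

lemma u_pos (p e : ℤ) : 0 < u p e := by unfold u; positivity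

lemma u_succ (p e : ℤ) : u p (e + 1) = 2 * u p e := by
  unfold u
  rw [show e + 1 + 1 - p = (e + 1 - p) + 1 by ring, zpow_add_one₀ (by norm_num)]
  ring

lemma u_mono (p : ℤ) {e e' : ℤ} (h : e ≤ e') : u p e ≤ u p e' := by
  unfold u
  exact zpow_le_zpow_right₀ (by norm_num) (by omega)

lemma u_multiple (p : ℤ) {e e' : ℤ} (h : e ≤ e') : ∃ m : ℤ, u p e' = m * u p e := by
  refine ⟨2 ^ (e' - e).toNat, ?_⟩
  unfold u
  push_cast
  rw [← zpow_natCast, ← zpow_add₀ (by norm_num)]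
  congr 1
  omega

lemma two_zpow_eq (p e H : ℤ) (hH : (2 : ℝ) ^ p = 4 * H) :
    (2 : ℝ) ^ e = 2 * H * u p e := by
  have : (2 : ℝ) ^ (e + 1) = (2 : ℝ) ^ p * u p e := by
    unfold u
    rw [← zpow_add₀ (by norm_num)]
    congr 1
    ring
  rw [zpow_add_one₀ (by norm_num), hH] at this
  linarith

lemma exists_H (p : ℤ) (hp : 2 ≤ p) : ∃ H : ℤ, 1 ≤ H ∧ (2 : ℝ) ^ p = 4 * H := by
  refine ⟨2 ^ (p - 2).toNat, one_le_pow₀ (by norm_num), ?_⟩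
  push_cast
  rw [← zpow_natCast, show (4 : ℝ) = 2 ^ (2 : ℤ) by norm_num, ← zpow_add₀ (by norm_num)]
  congr 1
  omega

lemma mem_F_iff (p emax H : ℤ) (hH : (2 : ℝ) ^ p = 4 * H) (x : ℝ) :
    x ∈ F p emax ↔ ∃ e k : ℤ, 1 - emax ≤ e ∧ e ≤ emax ∧ -(4 * H) < k ∧ k < 4 * H ∧
      x = k * u p e := by
  constructor
  · rintro ⟨s, e, M, hs, h1, h2, h3, h4, rfl⟩
    rw [hH] at h4
    have h3' : 0 ≤ M := by exact_mod_cast h3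
    have h4' : M ≤ 4 * H - 1 := by exact_mod_cast h4
    rcases hs with rfl | rfl
    · exact ⟨e, M, h1, h2, by omega, by omega, by simp [u]⟩
    · exact ⟨e, -M, h1, h2, by omega, by omega, by simp [u]⟩
  · rintro ⟨e, k, h1, h2, h3, h4, rfl⟩
    rcases le_total 0 k with hk | hk
    · refine ⟨1, e, k, Or.inl rfl, h1, h2, by exact_mod_cast hk, ?_, by simp [u]⟩
      rw [hH]
      have : k ≤ 4 * H - 1 := by omega
      exact_mod_cast this
    · refine ⟨-1, e, -k, Or.inr rfl, h1, h2, ?_, ?_, by simp [u]⟩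
      · have : 0 ≤ -k := by omega
        exact_mod_cast this
      rw [hH]
      have : -k ≤ 4 * H - 1 := by omega
      exact_mod_cast this

lemma canon (p emax H : ℤ) (x : ℝ) (n : ℕ) : ∀ e k : ℤ, e = 1 - emax + n → e ≤ emax →
    -(4 * H) < k → k < 4 * H → x = k * u p e →
    ∃ e k : ℤ, 1 - emax ≤ e ∧ e ≤ emax ∧ -(4 * H) < k ∧ k < 4 * H ∧
      x = k * u p e ∧ (e = 1 - emax ∨ 2 * H ≤ |k|) := by
  induction n with
  | zero =>
    intro e k h1 h2 h3 h4 h5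
    exact ⟨e, k, by omega, h2, h3, h4, h5, Or.inl (by simpa using h1)⟩
  | succ n ih =>
    intro e k h1 h2 h3 h4 h5
    by_cases hk : 2 * H ≤ |k|
    · exact ⟨e, k, by omega, h2, h3, h4, h5, Or.inr hk⟩
    · push Not at hk
      rw [abs_lt] at hk
      refine ih (e - 1) (2 * k) (by push_cast at h1; omega) (by omega) (by omega) (by omega) ?_
      rw [h5]
      have := u_succ p (e - 1)
      rw [sub_add_cancel] at this
      rw [this]
      push_cast
      ring

lemma even_of (p emax H e k : ℤ) (hH : (2 : ℝ) ^ p = 4 * H) (h1 : 1 - emax ≤ e)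
    (h3 : -(4 * H) < k) (h4 : k < 4 * H) (hc : e = 1 - emax ∨ 2 * H ≤ |k|) (hk : Even k) :
    FEven p emax (k * u p e) := by
  by_cases h0 : k = 0
  · left; simp [h0]
  right
  refine ⟨k, hk, ?_⟩
  have hu := u_pos p e
  have hz : 0 < |(k : ℝ) * u p e| := by
    rw [abs_pos]
    have : (k : ℝ) ≠ 0 := by exact_mod_cast h0
    positivity
  have habs : |(k : ℝ) * u p e| = (|k| : ℤ) * u p e := by
    rw [abs_mul, abs_of_pos hu, Int.cast_abs]
  have hlt : Int.log 2 |(k : ℝ) * u p e| < e + 1 := by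
    rw [← Int.lt_zpow_iff_log_lt (by norm_num) hz]
    have hk' : |k| < 4 * H := abs_lt.2 ⟨h3, h4⟩
    have hk'' : ((|k| : ℤ) : ℝ) < 4 * H := by exact_mod_cast hk'
    push_cast
    rw [two_zpow_eq p (e + 1) H hH, u_succ, habs]
    nlinarith
  have : max (1 - emax) (Int.log 2 |(k : ℝ) * u p e|) = e := by
    rcases hc with hc | hc
    · omega
    · have : e ≤ Int.log 2 |(k : ℝ) * u p e| := by
        rw [← Int.zpow_le_iff_le_log (by norm_num) hz]
        have hk'' : (2 * H : ℝ) ≤ ((|k| : ℤ) : ℝ) := by exact_mod_cast hc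
        push_cast
        rw [two_zpow_eq p e H hH, habs]
        nlinarith
      omega
  rw [this]
  rfl

/-- floats with a smaller exponent are small -/
lemma small (p H e e' k : ℤ) (hH1 : 1 ≤ H) (he : e' < e) (h3 : -(4 * H) < k) (h4 : k < 4 * H) :
    -(2 * H * u p e) < k * u p e' ∧ k * u p e' < 2 * H * u p e := by
  have hu := u_pos p e'
  have h2 : 2 * u p e' ≤ u p e := by rw [← u_succ]; exact u_mono p (by omega)
  have h3' : -(4 * H : ℝ) < k := by exact_mod_cast h3
  have h4' : (k : ℝ) < 4 * H := by exact_mod_cast h4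
  have hH' : (1 : ℝ) ≤ H := by exact_mod_cast hH1
  have := mul_le_mul_of_nonneg_left h2 (show (0 : ℝ) ≤ 2 * H by linarith)
  constructor <;> nlinarith

lemma below (p emax H e k : ℤ) (hH1 : 1 ≤ H) (hH : (2 : ℝ) ^ p = 4 * H)
    (hc : e = 1 - emax ∨ 2 * H ≤ |k|) (hk : k ≠ 2 * H) (w : ℝ)
    (hw : w ∈ F p emax) (hlt : w < k * u p e) : w ≤ (k - 1 : ℤ) * u p e := by
  have hu := u_pos p e
  obtain ⟨e', k', h1, h2, h3, h4, rfl⟩ := (mem_F_iff p emax H hH w).1 hw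
  rcases le_or_gt e e' with hee | hee
  · obtain ⟨m, hm⟩ := u_multiple p hee
    rw [hm, ← mul_assoc] at hlt ⊢
    have h5 := lt_of_mul_lt_mul_right hlt hu.le
    have h6 : k' * m < k := by exact_mod_cast h5
    have h7 : k' * m ≤ k - 1 := by omega
    have h8 : (k' : ℝ) * m ≤ (k - 1 : ℤ) := by exact_mod_cast h7
    exact mul_le_mul_of_nonneg_right h8 hu.le
  · obtain ⟨ha, hb⟩ := small p H e e' k' hH1 hee h3 h4
    have hc' : 2 * H ≤ |k| := by
      rcases hc with hc | hc
      · omega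
      · exact hc
    rcases le_abs.1 hc' with h | h
    · have : 2 * H ≤ k - 1 := by omega
      have h8 : (2 * H : ℝ) ≤ (k - 1 : ℤ) := by exact_mod_cast this
      have := mul_le_mul_of_nonneg_right h8 hu.le
      linarith
    · have : k ≤ -(2 * H) := by omega
      have h8 : (k : ℝ) ≤ -(2 * H) := by exact_mod_cast this
      have := mul_le_mul_of_nonneg_right h8 hu.le
      linarith

lemma fmax_eq (p emax H : ℤ) (hH1 : 1 ≤ H) (hH : (2 : ℝ) ^ p = 4 * H) :
    fmax p emax = (4 * H - 1) * u p emax := by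
  have hH' : (1 : ℝ) ≤ H := by exact_mod_cast hH1
  unfold fmax
  rw [two_zpow_eq p emax H hH, zpow_sub₀ (by norm_num), hH]
  field_simp
  ring

lemma thr_eq (p emax H : ℤ) (hH1 : 1 ≤ H) (hH : (2 : ℝ) ^ p = 4 * H) :
    (2 : ℝ) ^ emax * (2 - (2 : ℝ) ^ (-p)) = (4 * H - 1 / 2) * u p emax := by
  have hH' : (1 : ℝ) ≤ H := by exact_mod_cast hH1
  rw [two_zpow_eq p emax H hH, zpow_neg, hH]
  field_simp
  ring

lemma F_bound (p emax H : ℤ) (hH1 : 1 ≤ H) (hH : (2 : ℝ) ^ p = 4 * H) (x : ℝ)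
    (hx : x ∈ F p emax) : -fmax p emax ≤ x ∧ x ≤ fmax p emax := by
  rw [fmax_eq p emax H hH1 hH]
  obtain ⟨e, k, h1, h2, h3, h4, rfl⟩ := (mem_F_iff p emax H hH x).1 hx
  have hu := u_pos p e
  have hm := u_mono p h2
  have h3' : -(4 * H - 1) ≤ k := by omega
  have h4' : k ≤ 4 * H - 1 := by omega
  have h3'' : -(4 * H - 1 : ℝ) ≤ k := by exact_mod_cast h3'
  have h4'' : (k : ℝ) ≤ 4 * H - 1 := by exact_mod_cast h4'
  have hH' : (1 : ℝ) ≤ H := by exact_mod_cast hH1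
  have := mul_le_mul_of_nonneg_left hm (show (0 : ℝ) ≤ 4 * H - 1 by linarith)
  constructor <;> nlinarith

lemma neg_fmax_mem (p emax H : ℤ) (he : 1 ≤ emax) (hH1 : 1 ≤ H) (hH : (2 : ℝ) ^ p = 4 * H) :
    -fmax p emax ∈ F p emax := by
  rw [fmax_eq p emax H hH1 hH, mem_F_iff p emax H hH]
  exact ⟨emax, -(4 * H - 1), by omega, le_rfl, by omega, by omega, by push_cast; ring⟩

lemma fmax_mem (p emax H : ℤ) (he : 1 ≤ emax) (hH1 : 1 ≤ H) (hH : (2 : ℝ) ^ p = 4 * H) :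
    fmax p emax ∈ F p emax := by
  rw [fmax_eq p emax H hH1 hH, mem_F_iff p emax H hH]
  exact ⟨emax, 4 * H - 1, by omega, le_rfl, by omega, by omega, by push_cast; ring⟩

lemma F_finite (p emax H : ℤ) (hH : (2 : ℝ) ^ p = 4 * H) : (F p emax).Finite := by
  refine Set.Finite.subset (((Set.finite_Icc (1 - emax) emax).prod
    (Set.finite_Ioo (-(4 * H)) (4 * H))).image (fun q : ℤ × ℤ => (q.2 : ℝ) * u p q.1)) ?_
  intro x hx
  obtain ⟨e, k, h1, h2, h3, h4, rfl⟩ := (mem_F_iff p emax H hH x).1 hx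
  exact ⟨(e, k), ⟨⟨h1, h2⟩, ⟨h3, h4⟩⟩, rfl⟩

lemma fpred_greatest (p emax H : ℤ) (he : 1 ≤ emax) (hH1 : 1 ≤ H) (hH : (2 : ℝ) ^ p = 4 * H)
    (x : ℝ) (hx : x ∈ F p emax) (hne : x ≠ -fmax p emax) :
    fpred p emax x ∈ F p emax ∧ fpred p emax x < x := by
  have hfin : {y | y ∈ F p emax ∧ y < x}.Finite := (F_finite p emax H hH).subset fun y hy => hy.1
  have hn : {y | y ∈ F p emax ∧ y < x}.Nonempty :=
    ⟨_, neg_fmax_mem p emax H he hH1 hH,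
      lt_of_le_of_ne (F_bound p emax H hH1 hH x hx).1 (Ne.symm hne)⟩
  exact hn.csSup_mem hfin

lemma pred_even (p emax H : ℤ) (hH1 : 1 ≤ H) (hH : (2 : ℝ) ^ p = 4 * H)
    (x : ℝ) (hx : x ∈ F p emax) (hne : x ≠ -fmax p emax) (hodd : ¬ FEven p emax x) :
    FEven p emax (fpred p emax x) := by
  obtain ⟨e, k, h1, h2, h3, h4, h5⟩ := (mem_F_iff p emax H hH x).1 hx
  obtain ⟨e, k, h1, h2, h3, h4, rfl, hc⟩ :=
    canon p emax H x (e - (1 - emax)).toNat e k (by omega) h2 h3 h4 h5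
  have hk : ¬ Even k := fun hk => hodd (even_of p emax H e k hH h1 h3 h4 hc hk)
  have hk' : Even (k - 1) := by
    rw [Int.even_sub_one]
    exact hk
  have hk2 : k ≠ 2 * H := fun h => hk (h ▸ even_two_mul H)
  have key : (k - 1 : ℤ) * u p e ∈ F p emax ∧ FEven p emax ((k - 1 : ℤ) * u p e) := by
    by_cases hb : k - 1 = -(4 * H)
    · have hee : e ≠ emax := by
        rintro rfl
        apply hne
        rw [fmax_eq p e H hH1 hH, show k = -(4 * H) + 1 by omega]
        push_cast
        ring
      have hy : ((k - 1 : ℤ) : ℝ) * u p e = (-(2 * H) : ℤ) * u p (e + 1) := by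
        rw [hb, u_succ]
        push_cast
        ring
      rw [hy]
      refine ⟨(mem_F_iff p emax H hH _).2
        ⟨e + 1, -(2 * H), by omega, by omega, by omega, by omega, rfl⟩, ?_⟩
      exact even_of p emax H (e + 1) _ hH (by omega) (by omega) (by omega)
        (Or.inr (by rw [abs_neg]; exact le_abs_self _)) (even_two_mul H).neg
    · refine ⟨(mem_F_iff p emax H hH _).2 ⟨e, k - 1, h1, h2, by omega, by omega, rfl⟩, ?_⟩
      refine even_of p emax H e _ hH h1 (by omega) (by omega) ?_ hk'
      rcases hc with hc | hc
      · exact Or.inl hc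
      · right
        rcases le_abs.1 hc with h | h
        · exact le_abs.2 (Or.inl (by omega))
        · exact le_abs.2 (Or.inr (by omega))
  have : IsGreatest {y | y ∈ F p emax ∧ y < k * u p e} ((k - 1 : ℤ) * u p e) := by
    refine ⟨⟨key.1, ?_⟩, fun w hw => below p emax H e k hH1 hH hc hk2 w hw.1 hw.2⟩
    have := u_pos p e
    push_cast
    linarith
  unfold fpred
  rw [this.csSup_eq]
  exact key.2

lemma nearest_mem (p emax H : ℤ) (he : 1 ≤ emax) (hH1 : 1 ≤ H) (hH : (2 : ℝ) ^ p = 4 * H)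
    (r : ℝ) : nearest p emax r ∈ nearestSet p emax r := by
  have hex : ∃ z, z ∈ nearestSet p emax r := by
    obtain ⟨z, hz, hz'⟩ := Set.exists_min_image (F p emax) (fun z => |r - z|)
      (F_finite p emax H hH) ⟨_, fmax_mem p emax H he hH1 hH⟩
    exact ⟨z, hz, hz'⟩
  unfold nearest
  split_ifs with h
  · exact h.choose_spec.1
  · exact hex.choose_spec

lemma nearest_even (p emax : ℤ) (r : ℝ)
    (h : ∃ z, z ∈ nearestSet p emax r ∧ FEven p emax z) : FEven p emax (nearest p emax r) := by
  unfold nearest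
  rw [dif_pos h]
  exact h.choose_spec.2

end FPVerif

open FPVerif

/-- If `x ∈ 𝔽` and `x ≤ [r]n`, then `x + ∇2n−(x)/2 ≤ r`, strictly whenever
`x` is odd. -/
theorem le_rndNear_imp (p emax : ℤ) (hp : 2 ≤ p) (he : 1 ≤ emax)
    (x : ℝ) (hx : x ∈ F p emax) (r : ℝ)
    (h : (x : EReal) ≤ rndNear p emax r) :
    x + nablaNm p emax x / 2 ≤ r ∧
    (¬ FEven p emax x → x + nablaNm p emax x / 2 < r) := by
  obtain ⟨H, hH1, hH⟩ := exists_H p hp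
  have hu := u_pos p emax
  have hH' : (1 : ℝ) ≤ H := by exact_mod_cast hH1
  have hfm := fmax_eq p emax H hH1 hH
  have hb := F_bound p emax H hH1 hH x hx
  have hnabla : x ≠ -fmax p emax → nablaNm p emax x = fpred p emax x - x := by
    intro h
    simp [nablaNm, h]
  unfold rndNear at h
  rw [thr_eq p emax H hH1 hH] at h
  by_cases hx0 : x = -fmax p emax
  · have hs : x + u p emax ≤ fsucc p emax x := by
      refine le_csInf ⟨_, fmax_mem p emax H he hH1 hH, by rw [hx0, hfm]; nlinarith⟩ ?_
      rintro y ⟨hy, hxy⟩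
      rw [hx0, hfm] at hxy ⊢
      obtain ⟨e', k', h1, h2, h3, h4, rfl⟩ := (mem_F_iff p emax H hH y).1 hy
      rcases h2.lt_or_eq with h2 | rfl
      · have := (small p H emax e' k' hH1 h2 h3 h4).1
        nlinarith
      · rw [← neg_mul] at hxy
        have h5 := lt_of_mul_lt_mul_right hxy hu.le
        have h6 : -(4 * H - 1) < k' := by exact_mod_cast h5
        have h7 : -(4 * H - 1) + 1 ≤ k' := by omega
        have h8 : -(4 * H - 1 : ℝ) + 1 ≤ k' := by exact_mod_cast h7
        nlinarith
    have hn : nablaNm p emax x = x - fsucc p emax x := by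
      unfold nablaNm
      rw [if_pos hx0]
    have hlt : x + nablaNm p emax x / 2 < r := by
      rw [hn]
      split_ifs at h with ha hb'
      · nlinarith
      · exact absurd h (by simp)
      · push Not at hb'
        nlinarith
    exact ⟨hlt.le, fun _ => hlt⟩
  · obtain ⟨hpm, hpl⟩ := fpred_greatest p emax H he hH1 hH x hx hx0
    rw [hnabla hx0]
    split_ifs at h with ha hb'
    · have hlt : x + (fpred p emax x - x) / 2 < r := by nlinarith
      exact ⟨hlt.le, fun _ => hlt⟩
    · exact absurd h (by simp)
    · have hxz : x ≤ nearest p emax r := by exact_mod_cast h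
      obtain ⟨hz1, hz2⟩ := nearest_mem p emax H he hH1 hH r
      have hd := hz2 _ hpm
      have hle : (nearest p emax r + fpred p emax x) / 2 ≤ r := by
        by_contra hcon
        push Not at hcon
        have : |r - fpred p emax x| < |r - nearest p emax r| := by
          rw [abs_of_neg (show r - nearest p emax r < 0 by linarith), abs_lt]
          constructor <;> linarith
        linarith
      refine ⟨by linarith, fun hodd => ?_⟩
      by_contra hcon
      push Not at hcon
      have hzx : nearest p emax r = x := by linarith
      have hr : r = (x + fpred p emax x) / 2 := by linarith
      have heq : |r - fpred p emax x| = |r - nearest p emax r| := by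
        rw [hzx, abs_of_pos (show 0 < r - fpred p emax x by linarith),
          abs_of_neg (show r - x < 0 by linarith)]
        linarith
      apply hodd
      rw [← hzx]
      apply nearest_even
      exact ⟨fpred p emax x, ⟨hpm, fun w hw => heq ▸ hz2 w hw⟩,
        pred_even p emax H hH1 hH x hx hx0 hodd⟩
end
end
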